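/- Let a be a nonnegative element of the descent algebra Σ(W) and n ≥ 1. Then the centralizer of aⁿ in Σ(W) equals the centralizer of a: Z_{Σ(W)}(aⁿ) = Z_{Σ(W)}(a). -/

import Mathlib

open MonoidAlgebra

variable {B W : Type*} [DecidableEq B] [Fintype B] [Group W] [Fintype W] [DecidableEq W]

/-- `x_I`: the sum, in the group algebra `ℚW`, of the minimal length coset
representatives of the standard parabolic subgroup `W_I` in `W`, i.e. the sum of the
`w ∈ W` such that `ws > w` for all `s ∈ I`. -/
noncomputable def descentBasis {M : CoxeterMatrix B} (cs : CoxeterSystem M W)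
    (I : Finset B) : MonoidAlgebra ℚ W :=
  ∑ w : W, if ∀ i ∈ I, cs.length w < cs.length (w * cs.simple i)
    then MonoidAlgebra.single w (1 : ℚ) else 0

/-- `A` is the Solomon descent algebra `Σ(W)` of `(W,S)`: a subalgebra of the group
algebra `ℚW` whose underlying set is the span of the elements `x_I`, `I ⊆ S`.
(By Solomon's theorem this span is indeed closed under multiplication.) -/
def IsDescentAlgebra {M : CoxeterMatrix B} (cs : CoxeterSystem M W)
    (A : Subalgebra ℚ (MonoidAlgebra ℚ W)) : Prop :=
  (A : Set (MonoidAlgebra ℚ W)) = Submodule.span ℚ (Set.range (descentBasis cs))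

set_option linter.unusedSectionVars false

section LinAlg

open Polynomial in
/-- A triangularity criterion for diagonalizability with nonnegative eigenvalues. -/
theorem aux_commute {R ι : Type*} [Ring R] [Algebra ℚ R] [Fintype ι]
    (x : ι → R) (a : R) (l : ι → ℚ) (hl : ∀ j, 0 ≤ l j)
    (h : ∀ j, a * x j - l j • x j ∈ Submodule.span ℚ (x '' {k | l j < l k}))
    (j0 : ι) (h1 : x j0 = 1) (n : ℕ) (hn : 1 ≤ n) (y : R)
    (hy : a ^ n * y = y * a ^ n) : a * y = y * a := by
  classical
  set L : Finset ℚ := Finset.univ.image l with hL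
  have hLnn : ∀ q ∈ L, 0 ≤ q := by
    intro q hq
    obtain ⟨j, -, rfl⟩ := Finset.mem_image.1 hq
    exact hl j
  -- the product over the eigenvalues at least `l j` kills `x j`
  have key : ∀ N : ℕ, ∀ j, (L.filter (fun q => l j ≤ q)).card = N →
      aeval a (∏ q ∈ L.filter (fun q => l j ≤ q), (X - C q)) * x j = 0 := by
    intro N
    induction N using Nat.strong_induction_on with
    | _ N ih =>
      intro j hj
      have hmem : l j ∈ L.filter (fun q => l j ≤ q) := by simp [hL]
      rw [← Finset.prod_erase_mul _ _ hmem, map_mul, mul_assoc]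
      have e1 : aeval a (X - C (l j)) * x j = a * x j - l j • x j := by
        simp [sub_mul, Algebra.smul_def]
      rw [e1]
      have hs : ∀ z ∈ Submodule.span ℚ (x '' {k | l j < l k}),
          aeval a (∏ q ∈ (L.filter (fun q => l j ≤ q)).erase (l j), (X - C q)) * z = 0 := by
        intro z hz
        induction hz using Submodule.span_induction with
        | mem z hz =>
          obtain ⟨k, hk, rfl⟩ := hz
          have hk' : l j < l k := hk
          have hsub : L.filter (fun q => l k ≤ q) ⊆ (L.filter (fun q => l j ≤ q)).erase (l j) := by
            intro q hq
            simp only [Finset.mem_filter, Finset.mem_erase] at hq ⊢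
            exact ⟨(hk'.trans_le hq.2).ne', hq.1, hk'.le.trans hq.2⟩
          have hlt : (L.filter (fun q => l k ≤ q)).card < N := by
            rw [← hj]
            exact (Finset.card_le_card hsub).trans_lt (Finset.card_erase_lt_of_mem hmem)
          rw [← Finset.prod_sdiff hsub, map_mul, mul_assoc, ih _ hlt k rfl, mul_zero]
        | zero => simp
        | add u v _ _ hu hv => rw [mul_add, hu, hv, add_zero]
        | smul r u _ hu => rw [mul_smul_comm, hu, smul_zero]
      exact hs _ (h j)
  have hp : aeval a (∏ q ∈ L, (X - C q)) = 0 := by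
    have := key _ j0 rfl
    rw [h1, mul_one] at this
    rw [← Finset.prod_sdiff (Finset.filter_subset (fun q => l j0 ≤ q) L), map_mul, this, mul_zero]
  -- interpolation
  have hinj : Set.InjOn (fun q : ℚ => q ^ n) (L : Set ℚ) := by
    intro p hp q hq hpq
    exact (pow_left_inj₀ (hLnn p hp) (hLnn q hq) (by omega)).1 hpq
  set Q := Lagrange.interpolate L (fun q : ℚ => q ^ n) (fun q => q) with hQ
  have hev : ∀ q ∈ L, Q.eval (q ^ n) = q := by
    intro q hq
    exact Lagrange.eval_interpolate_at_node (fun q => q) hinj hq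
  have hdvd : (∏ q ∈ L, (X - C q)) ∣ (Q.comp (X ^ n) - X) := by
    apply Finset.prod_dvd_of_coprime
    · intro p _ q _ hpq
      exact pairwise_coprime_X_sub_C (s := fun q : ℚ => q) (fun _ _ h => h) hpq
    · intro q hq
      rw [dvd_iff_isRoot]
      simp [hev q hq]
  have ha : aeval (a ^ n) Q = a := by
    obtain ⟨P, hP⟩ := hdvd
    have := congrArg (aeval a) hP
    rw [map_mul, hp, zero_mul, map_sub, aeval_comp, sub_eq_zero] at this
    simpa using this
  have hc : Commute (a ^ n) y := hy
  have : Commute (aeval (a ^ n) Q) y := by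
    induction Q using Polynomial.induction_on' with
    | add p q hp hq => 
      rw [map_add]
      exact Commute.add_left hp hq
    | monomial k r =>
      rw [aeval_monomial]
      exact (show Commute _ _ from Algebra.commutes r y).mul_left (hc.pow_left k)
  rw [ha] at this
  exact this

end LinAlg

section Cocycle

variable {M : CoxeterMatrix B} (cs : CoxeterSystem M W)

theorem end_mul_apply {α : Type*} (f g : Function.End α) (p : α) : (f * g) p = f (g p) := rfl

theorem end_one_apply {α : Type*} (p : α) : (1 : Function.End α) p = p := rfl

/-- The elementary involution of `W × ℤ/2` attached to a simple reflection. -/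
def invStep (i : B) : Function.End (W × ZMod 2) :=
  fun p => (cs.simple i * p.1 * cs.simple i, p.2 + if p.1 = cs.simple i then 1 else 0)

theorem invStep_pow (i j : B) (k : ℕ) (t : W) (z : ZMod 2) :
    ((invStep cs i * invStep cs j) ^ k) (t, z) =
      ((cs.simple i * cs.simple j) ^ k * t * ((cs.simple i * cs.simple j) ^ k)⁻¹,
        z + ∑ l ∈ Finset.range (2 * k),
          if t = ((cs.simple i * cs.simple j) ^ l)⁻¹ * cs.simple j then 1 else 0) := by
  set g := cs.simple i * cs.simple j with hg
  have hgj : ∀ l : ℕ, cs.simple j * g ^ l = (g ^ l)⁻¹ * cs.simple j := by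
    intro l
    induction l with
    | zero => simp
    | succ l ih =>
      have hj : cs.simple j * g = g⁻¹ * cs.simple j := by simp [hg, mul_assoc]
      rw [pow_succ', ← mul_assoc, hj, mul_assoc, ih, ← mul_assoc, ← mul_inv_rev, ← pow_succ, pow_succ']
  induction k with
  | zero => simp [end_one_apply]
  | succ k ih =>
    rw [pow_succ', end_mul_apply, ih, end_mul_apply]
    simp only [invStep]
    have e : 2 * (k + 1) = 2 * k + 1 + 1 := by ring
    rw [e, Finset.sum_range_succ, Finset.sum_range_succ]
    have c1 : (g ^ k * t * (g ^ k)⁻¹ = cs.simple j) ↔ t = (g ^ (2 * k))⁻¹ * cs.simple j := by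
      rw [two_mul, pow_add, mul_inv_rev, mul_assoc _ _ (cs.simple j), ← hgj]
      constructor
      · intro h; rw [← h]; group
      · intro h; rw [h]; group
    have c2 : (cs.simple j * (g ^ k * t * (g ^ k)⁻¹) * cs.simple j = cs.simple i) ↔
        t = (g ^ (2 * k + 1))⁻¹ * cs.simple j := by
      have e1 : 2 * k + 1 = k + 1 + k := by ring
      rw [e1, pow_add, mul_inv_rev, mul_assoc (g ^ k)⁻¹ _ (cs.simple j), ← hgj]
      have e2 : cs.simple j * g ^ (k+1) = cs.simple j * cs.simple i * cs.simple j * g ^ k := by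
        rw [pow_succ', hg]; simp only [mul_assoc]
      rw [e2]
      have e3 : cs.simple j * cs.simple j = 1 := cs.simple_mul_simple_self j
      have e4 : (cs.simple j)⁻¹ = cs.simple j := cs.inv_simple j
      constructor
      · intro h; rw [← h]; simp [mul_assoc]
      · intro h; rw [h]; simp [mul_assoc]
    simp only [c1, c2]
    ext
    · simp [pow_succ', mul_assoc, hg]
    · simp [add_assoc]

theorem invStep_liftable : M.IsLiftable (invStep cs) := by
  intro i j
  funext p
  obtain ⟨t, z⟩ := p
  rw [invStep_pow]
  have hg : (cs.simple i * cs.simple j) ^ (M i j) = 1 := cs.simple_mul_simple_pow i j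
  rw [two_mul, Finset.sum_range_add]
  simp only [pow_add, hg, one_mul, CharTwo.add_self_eq_zero]
  simp [end_one_apply]

theorem exists_cocycle : ∃ η : W → W → ZMod 2,
    (∀ i t, η (cs.simple i) t = if t = cs.simple i then 1 else 0) ∧
    (∀ u v t, η (u * v) t = η v t + η u (v * t * v⁻¹)) := by
  set Φ := cs.lift ⟨invStep cs, invStep_liftable cs⟩ with hΦ
  have hs : ∀ i, Φ (cs.simple i) = invStep cs i := fun i => cs.lift_apply_simple _ i
  have hform : ∀ w : W, ∀ t z, Φ w (t, z) = (w * t * w⁻¹, z + (Φ w (t, 0)).2) := by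
    intro w
    induction w using cs.simple_induction_left with
    | one => intro t z; simp [end_one_apply]
    | mul_simple_left w i ih =>
      intro t z
      rw [map_mul, end_mul_apply, end_mul_apply, ih t z, ih t 0,
        hs]
      simp [invStep, mul_assoc, add_assoc]
  refine ⟨fun w t => (Φ w (t, 0)).2, ?_, ?_⟩
  · intro i t
    simp [hs, invStep]
  · intro u v t
    show (Φ (u * v) (t, 0)).2 = _
    rw [map_mul, end_mul_apply, hform v t 0, hform u]
    simp

/-- The inversion cocycle. -/
noncomputable def eta (w t : W) : ZMod 2 := (exists_cocycle cs).choose w t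

theorem eta_simple (i : B) (t : W) : eta cs (cs.simple i) t = if t = cs.simple i then 1 else 0 :=
  (exists_cocycle cs).choose_spec.1 i t

theorem eta_mul (u v t : W) : eta cs (u * v) t = eta cs v t + eta cs u (v * t * v⁻¹) :=
  (exists_cocycle cs).choose_spec.2 u v t

theorem eta_one (t : W) : eta cs 1 t = 0 := by
  have := eta_mul cs 1 1 t
  simpa using this

theorem zmod2_ne {z : ZMod 2} (h : z ≠ 0) : z = 1 := by
  revert h; revert z; decide

theorem eta_exchange (ω : List B) (t : W) (h : eta cs (cs.wordProd ω) t ≠ 0) :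
    ∃ ω' : List B, ω'.Sublist ω ∧ ω'.length + 1 = ω.length ∧
      cs.wordProd ω' = cs.wordProd ω * t := by
  induction ω with
  | nil => simp [eta_one] at h
  | cons i ω ih =>
    by_cases h0 : eta cs (cs.wordProd ω) t = 0
    · rw [cs.wordProd_cons, eta_mul, h0, zero_add, eta_simple] at h
      have h2 : cs.wordProd ω * t * (cs.wordProd ω)⁻¹ = cs.simple i := by
        by_contra hne
        exact h (if_neg hne)
      refine ⟨ω, List.sublist_cons_self _ _, rfl, ?_⟩
      rw [cs.wordProd_cons, ← h2]
      have : cs.wordProd ω * t = cs.simple i * cs.wordProd ω := by rw [← h2]; group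
      rw [h2, mul_assoc, this]; simp
    · obtain ⟨ω', h1, h2, h3⟩ := ih h0
      refine ⟨i :: ω', h1.cons_cons i, by simp [h2], ?_⟩
      rw [cs.wordProd_cons, cs.wordProd_cons, h3, mul_assoc]

theorem eta_length {w t : W} (h : eta cs w t ≠ 0) : cs.length (w * t) < cs.length w := by
  obtain ⟨ω, hω, rfl⟩ := cs.exists_isReduced w
  obtain ⟨ω', h1, h2, h3⟩ := eta_exchange cs ω t h
  rw [← h3, hω.eq]
  have := cs.length_wordProd_le ω'
  omega

theorem eta_simple_iff (w : W) (i : B) :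
    eta cs w (cs.simple i) = 0 ↔ cs.length w < cs.length (w * cs.simple i) := by
  constructor
  · intro h
    have : eta cs (w * cs.simple i) (cs.simple i) ≠ 0 := by
      rw [eta_mul, eta_simple]; simp [h]
    have := eta_length cs this
    simpa [mul_assoc] using this
  · intro h
    by_contra hne
    exact absurd (eta_length cs hne) (by omega)

/-- The standard parabolic subgroup. -/
def par (I : Finset B) : Subgroup W where
  carrier := {w | ∃ ω : List B, (∀ i ∈ ω, i ∈ I) ∧ cs.wordProd ω = w}
  one_mem' := ⟨[], by simp, by simp⟩
  mul_mem' := by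
    rintro _ _ ⟨ω, h, rfl⟩ ⟨ω', h', rfl⟩
    refine ⟨ω ++ ω', ?_, cs.wordProd_append _ _⟩
    intro i hi
    rcases List.mem_append.1 hi with hi | hi
    exacts [h i hi, h' i hi]
  inv_mem' := by
    rintro _ ⟨ω, h, rfl⟩
    exact ⟨ω.reverse, by simpa using h, by simp⟩

theorem mem_par {I : Finset B} {w : W} :
    w ∈ par cs I ↔ ∃ ω : List B, (∀ i ∈ ω, i ∈ I) ∧ cs.wordProd ω = w := Iff.rfl

theorem simple_mem_par {I : Finset B} {i : B} (hi : i ∈ I) : cs.simple i ∈ par cs I :=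
  ⟨[i], by simpa using hi, by simp⟩

/-- The reflections of the standard parabolic subgroup. -/
def parRefl (I : Finset B) (t : W) : Prop :=
  ∃ r ∈ par cs I, ∃ i ∈ I, t = r * cs.simple i * r⁻¹

theorem parRefl_mem {I : Finset B} {t : W} (h : parRefl cs I t) : t ∈ par cs I := by
  obtain ⟨r, hr, i, hi, rfl⟩ := h
  exact mul_mem (mul_mem hr (simple_mem_par cs hi)) (inv_mem hr)

theorem parRefl_conj {I : Finset B} {t b : W} (hb : b ∈ par cs I) (h : parRefl cs I t) :
    parRefl cs I (b * t * b⁻¹) := by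
  obtain ⟨r, hr, i, hi, rfl⟩ := h
  exact ⟨b * r, mul_mem hb hr, i, hi, by group⟩

theorem parRefl_simple {I : Finset B} {i : B} (hi : i ∈ I) : parRefl cs I (cs.simple i) :=
  ⟨1, one_mem _, i, hi, by simp⟩

theorem parRefl_of_eta {I : Finset B} {b t : W} (hb : b ∈ par cs I) (h : eta cs b t ≠ 0) :
    parRefl cs I t := by
  obtain ⟨ω, hω, rfl⟩ := hb
  induction ω with
  | nil => simp [eta_one] at h
  | cons i ω ih =>
    have hω' : ∀ i ∈ ω, i ∈ I := fun j hj => hω j (List.mem_cons_of_mem _ hj)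
    by_cases h0 : eta cs (cs.wordProd ω) t = 0
    · rw [cs.wordProd_cons, eta_mul, h0, zero_add, eta_simple] at h
      have h2 : cs.wordProd ω * t * (cs.wordProd ω)⁻¹ = cs.simple i := by
        by_contra hne
        exact h (if_neg hne)
      refine ⟨(cs.wordProd ω)⁻¹, inv_mem ⟨ω, hω', rfl⟩, i, hω i List.mem_cons_self, ?_⟩
      rw [← h2]; group
    · exact ih hω' h0

/-- The set `X_I`. -/
def inX (I : Finset B) (w : W) : Prop :=
  ∀ i ∈ I, cs.length w < cs.length (w * cs.simple i)

theorem inX_iff {I : Finset B} {w : W} : inX cs I w ↔ ∀ i ∈ I, eta cs w (cs.simple i) = 0 := by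
  unfold inX
  simp only [eta_simple_iff]

theorem eq_one_of_par {I : Finset B} {b : W} (hb : b ∈ par cs I) (h : inX cs I b) : b = 1 := by
  classical
  rw [inX_iff] at h
  have hex : ∃ k, ∃ ω : List B, (∀ i ∈ ω, i ∈ I) ∧ cs.wordProd ω = b ∧ ω.length = k := by
    obtain ⟨ω, h1, h2⟩ := hb
    exact ⟨_, ω, h1, h2, rfl⟩
  obtain ⟨ω, h1, h2, h3⟩ := Nat.find_spec hex
  have hmin : ∀ ω' : List B, (∀ i ∈ ω', i ∈ I) → cs.wordProd ω' = b → ω.length ≤ ω'.length := by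
    intro ω' h1' h2'
    rw [h3]
    exact Nat.find_min' hex ⟨ω', h1', h2', rfl⟩
  rcases List.eq_nil_or_concat ω with rfl | ⟨ω₀, i, rfl⟩
  · simpa using h2.symm
  · exfalso
    have hi : i ∈ I := h1 i (by simp)
    rw [cs.wordProd_concat] at h2
    have h4 : cs.wordProd ω₀ = b * cs.simple i := by rw [← h2]; simp
    have h5 : eta cs (cs.wordProd ω₀) (cs.simple i) ≠ 0 := by
      rw [h4, eta_mul, eta_simple]; simp [h i hi]
    obtain ⟨ω', g1, g2, g3⟩ := eta_exchange cs ω₀ _ h5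
    have := hmin ω' (fun j hj => h1 j (by simp [g1.subset hj])) (by rw [g3, h2])
    simp at this
    omega

theorem exists_min (I : Finset B) (w : W) : ∃ m, w⁻¹ * m ∈ par cs I ∧
    ∀ t, parRefl cs I t → eta cs m t = 0 := by
  classical
  obtain ⟨m, hm, hmin⟩ := Finset.exists_min_image
    (Finset.univ.filter (fun m => w⁻¹ * m ∈ par cs I)) cs.length ⟨w, by simp⟩
  simp only [Finset.mem_filter, Finset.mem_univ, true_and] at hm hmin
  refine ⟨m, hm, fun t ht => ?_⟩
  by_contra hne
  have h1 := eta_length cs hne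
  have h2 := hmin (m * t) (by rw [← mul_assoc]; exact mul_mem hm (parRefl_mem cs ht))
  omega

theorem inX_refl {I : Finset B} {u t : W} (hu : inX cs I u) (ht : parRefl cs I t) :
    eta cs u t = 0 := by
  obtain ⟨m, hm, h⟩ := exists_min cs I u
  have hb : m⁻¹ * u ∈ par cs I := by simpa using inv_mem hm
  have h1 : m⁻¹ * u = 1 := by
    refine eq_one_of_par cs hb ?_
    rw [inX_iff] at hu ⊢
    intro i hi
    have e := hu i hi
    rw [show u = m * (m⁻¹ * u) by group, eta_mul,
      h _ (parRefl_conj cs hb (parRefl_simple cs hi)), add_zero] at e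
    exact e
  have : u = m := by rw [inv_mul_eq_one] at h1; exact h1.symm
  rw [this]
  exact h t ht

theorem inX_unique {I : Finset B} {u v : W} (hu : inX cs I u) (hv : inX cs I v)
    (h : u⁻¹ * v ∈ par cs I) : u = v := by
  rw [← inv_mul_eq_one]
  refine eq_one_of_par cs h ?_
  rw [inX_iff] at hv ⊢
  intro i hi
  have e := hv i hi
  rw [show v = u * (u⁻¹ * v) by group, eta_mul,
    inX_refl cs hu (parRefl_conj cs h (parRefl_simple cs hi)), add_zero] at e
  exact e

theorem exists_mr (I : Finset B) (w : W) : ∃ m, w⁻¹ * m ∈ par cs I ∧ inX cs I m := by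
  obtain ⟨m, hm, h⟩ := exists_min cs I w
  exact ⟨m, hm, (inX_iff cs).2 fun i hi => h _ (parRefl_simple cs hi)⟩

/-- Minimal coset representative. -/
noncomputable def mr (I : Finset B) (w : W) : W := (exists_mr cs I w).choose

theorem mr_par (I : Finset B) (w : W) : w⁻¹ * mr cs I w ∈ par cs I :=
  (exists_mr cs I w).choose_spec.1

theorem mr_inX (I : Finset B) (w : W) : inX cs I (mr cs I w) :=
  (exists_mr cs I w).choose_spec.2

open Classical in
/-- The set `I^d ∩ J`. -/
noncomputable def interK (I J : Finset B) (d : W) : Finset B :=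
  J.filter (fun j => parRefl cs I (d * cs.simple j * d⁻¹))

theorem eta_of_refl {I : Finset B} {d : W} {i : B} (hd : inX cs I d⁻¹)
    (h : parRefl cs I (d * cs.simple i * d⁻¹)) : eta cs d (cs.simple i) = 0 := by
  have := eta_mul cs d⁻¹ d (cs.simple i)
  rw [inX_refl cs hd h, add_zero, inv_mul_cancel, eta_one] at this
  exact this.symm

theorem mackey_key {I J : Finset B} {u d w : W} (hu : inX cs I u) (hd : inX cs I d⁻¹)
    (hb : u⁻¹ * w * d⁻¹ ∈ par cs I) :
    inX cs J (u⁻¹ * w) ↔ inX cs J d ∧ inX cs (interK cs I J d) w := by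
  set b := u⁻¹ * w * d⁻¹ with hbdef
  have e1 : u⁻¹ * w = b * d := by rw [hbdef]; group
  have e2 : w = u * (b * d) := by rw [hbdef]; group
  have f1 : ∀ s, ¬ parRefl cs I (d * s * d⁻¹) → eta cs (b * d) s = eta cs d s := by
    intro s hs
    rw [eta_mul]
    by_contra hne
    exact hs (parRefl_of_eta cs hb fun h0 => hne (by rw [h0, add_zero]))
  have f2 : ∀ s, parRefl cs I (d * s * d⁻¹) → eta cs w s = eta cs (b * d) s := by
    intro s hs
    rw [e2, eta_mul cs u]
    have : b * d * s * (b * d)⁻¹ = b * (d * s * d⁻¹) * b⁻¹ := by group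
    rw [this, inX_refl cs hu (parRefl_conj cs hb hs), add_zero]
  rw [e1, inX_iff, inX_iff, inX_iff]
  simp only [interK, Finset.mem_filter]
  constructor
  · intro h
    refine ⟨fun j hj => ?_, fun j hj => ?_⟩
    · by_cases hr : parRefl cs I (d * cs.simple j * d⁻¹)
      · exact eta_of_refl cs hd hr
      · rw [← f1 _ hr]; exact h j hj
    · rw [f2 _ hj.2]; exact h j hj.1
  · rintro ⟨h1, h2⟩ j hj
    by_cases hr : parRefl cs I (d * cs.simple j * d⁻¹)
    · rw [← f2 _ hr]; exact h2 j ⟨hj, hr⟩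
    · rw [f1 _ hr]; exact h1 j hj

open Classical in
theorem descentBasis_apply (I : Finset B) (w : W) :
    (descentBasis cs I).coeff w = if inX cs I w then 1 else 0 := by
  unfold descentBasis
  rw [MonoidAlgebra.coeff_sum, Finsupp.finsetSum_apply, Finset.sum_eq_single w]
  · by_cases h : inX cs I w
    · have h' := h
      unfold inX at h'
      rw [if_pos h, if_pos h']; simp
    · have h' := h
      unfold inX at h'
      rw [if_neg h, if_neg h']; simp
  · intro v _ hv
    split_ifs <;> simp [hv]
  · simp

theorem descentBasis_mul_coeff (I : Finset B) (y : MonoidAlgebra ℚ W) (w : W) :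
    (descentBasis cs I * y).coeff w = ∑ u : W, open Classical in
      if inX cs I u then y.coeff (u⁻¹ * w) else 0 := by
  unfold descentBasis
  rw [Finset.sum_mul, MonoidAlgebra.coeff_sum, Finsupp.finsetSum_apply]
  refine Finset.sum_congr rfl fun u _ => ?_
  by_cases h : inX cs I u
  · have h' := h
    unfold inX at h'
    rw [if_pos h, if_pos h']; simp
  · have h' := h
    unfold inX at h'
    rw [if_neg h, if_neg h']; simp

open Classical in
theorem mackey (I J : Finset B) : descentBasis cs I * descentBasis cs J =
    ∑ d ∈ Finset.univ.filter (fun d => inX cs I d⁻¹ ∧ inX cs J d),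
      descentBasis cs (interK cs I J d) := by
  ext w
  rw [descentBasis_mul_coeff, MonoidAlgebra.coeff_sum, Finsupp.finsetSum_apply]
  simp only [descentBasis_apply]
  rw [← Finset.sum_filter, ← Finset.sum_filter, ← Finset.sum_filter, Finset.filter_filter,
    Finset.filter_filter]
  have hpar : ∀ u, u⁻¹ * w * ((mr cs I (w⁻¹ * u))⁻¹)⁻¹ ∈ par cs I := by
    intro u
    simpa [mul_assoc] using mr_par cs I (w⁻¹ * u)
  have hpar' : ∀ d, (mr cs I (w * d⁻¹))⁻¹ * w * d⁻¹ ∈ par cs I := by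
    intro d
    simpa [mul_assoc] using inv_mem (mr_par cs I (w * d⁻¹))
  refine Finset.sum_nbij' (fun u => (mr cs I (w⁻¹ * u))⁻¹) (fun d => mr cs I (w * d⁻¹))
    ?_ ?_ ?_ ?_ ?_
  · intro u hu
    simp only [Finset.mem_filter, Finset.mem_univ, true_and] at hu ⊢
    have hd : inX cs I ((mr cs I (w⁻¹ * u))⁻¹)⁻¹ := by rw [inv_inv]; exact mr_inX cs I _
    have := (mackey_key cs hu.1 hd (hpar u)).1 hu.2
    exact ⟨⟨hd, this.1⟩, this.2⟩
  · intro d hd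
    simp only [Finset.mem_filter, Finset.mem_univ, true_and] at hd ⊢
    exact ⟨mr_inX cs I _, (mackey_key cs (mr_inX cs I _) hd.1.1 (hpar' d)).2 ⟨hd.1.2, hd.2⟩⟩
  · intro u hu
    simp only [Finset.mem_filter, Finset.mem_univ, true_and] at hu ⊢
    refine inX_unique cs (mr_inX cs I _) hu.1 ?_
    have h1 := hpar' (mr cs I (w⁻¹ * u))⁻¹
    have h2 := inv_mem (hpar u)
    simpa [mul_assoc] using mul_mem h1 h2
  · intro d hd
    simp only [Finset.mem_filter, Finset.mem_univ, true_and] at hd ⊢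
    rw [inv_eq_iff_eq_inv]
    refine inX_unique cs (mr_inX cs I _) hd.1.1 ?_
    have h1 := inv_mem (mr_par cs I (w⁻¹ * mr cs I (w * d⁻¹)))
    have h2 := hpar' d
    simpa [mul_assoc] using mul_mem h1 h2
  · intro _ _; rfl

theorem descentBasis_univ : descentBasis cs Finset.univ = 1 := by
  ext w
  rw [descentBasis_apply, MonoidAlgebra.one_def, MonoidAlgebra.coeff_single, Finsupp.single_apply]
  have : inX cs Finset.univ w ↔ 1 = w := by
    constructor
    · intro h
      by_contra hne
      obtain ⟨i, hi⟩ := cs.exists_rightDescent_of_ne_one (Ne.symm hne)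
      have h1 := h i (Finset.mem_univ _)
      unfold CoxeterSystem.IsRightDescent at hi
      omega
    · rintro rfl i _
      simp
  simp only [this]

open Classical in
/-- The elements `d` contributing to the diagonal coefficient. -/
noncomputable def diagSet (I J : Finset B) : Finset W :=
  Finset.univ.filter (fun d => inX cs I d⁻¹ ∧ ∀ j ∈ J, parRefl cs I (d * cs.simple j * d⁻¹))

theorem diagSet_mono (I : Finset B) {J K : Finset B} (h : K ⊆ J) :
    diagSet cs I J ⊆ diagSet cs I K := by
  intro d hd
  simp only [diagSet, Finset.mem_filter, Finset.mem_univ, true_and] at hd ⊢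
  exact ⟨hd.1, fun j hj => hd.2 j (h hj)⟩

theorem interK_subset (I J : Finset B) (d : W) : interK cs I J d ⊆ J := by
  classical
  unfold interK
  exact Finset.filter_subset _ _

theorem interK_eq_iff (I J : Finset B) (d : W) :
    interK cs I J d = J ↔ ∀ j ∈ J, parRefl cs I (d * cs.simple j * d⁻¹) := by
  classical
  unfold interK
  exact Finset.filter_eq_self

open Classical in
theorem mackey_split (I J : Finset B) : descentBasis cs I * descentBasis cs J =
    ((diagSet cs I J).card : ℚ) • descentBasis cs J +
    ∑ d ∈ Finset.univ.filter (fun d => (inX cs I d⁻¹ ∧ inX cs J d) ∧ interK cs I J d ≠ J),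
      descentBasis cs (interK cs I J d) := by
  rw [mackey, ← Finset.sum_filter_add_sum_filter_not _ (fun d => interK cs I J d = J),
    Finset.filter_filter, Finset.filter_filter]
  congr 1
  have e : Finset.univ.filter (fun d => (inX cs I d⁻¹ ∧ inX cs J d) ∧ interK cs I J d = J) =
      diagSet cs I J := by
    ext d
    simp only [diagSet, Finset.mem_filter, Finset.mem_univ, true_and, interK_eq_iff]
    constructor
    · rintro ⟨h1, h2⟩
      exact ⟨h1.1, h2⟩
    · rintro ⟨h1, h2⟩
      exact ⟨⟨h1, (inX_iff cs).2 fun j hj => eta_of_refl cs h1 (h2 j hj)⟩, h2⟩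
  rw [e, Finset.sum_congr rfl (g := fun _ => descentBasis cs J), Finset.sum_const,
    Nat.cast_smul_eq_nsmul]
  intro d hd
  simp only [diagSet, Finset.mem_filter, Finset.mem_univ, true_and] at hd
  rw [(interK_eq_iff cs I J d).2 hd.2]

theorem diagSet_card_lt {I J : Finset B} {d : W} (hd : inX cs I d⁻¹)
    (h : interK cs I J d ≠ J) :
    (diagSet cs I J).card < (diagSet cs I (interK cs I J d)).card := by
  apply Finset.card_lt_card
  rw [Finset.ssubset_iff_of_subset (diagSet_mono cs I (interK_subset cs I J d))]
  refine ⟨d, ?_, ?_⟩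
  · simp only [diagSet, Finset.mem_filter, Finset.mem_univ, true_and]
    refine ⟨hd, fun j hj => ?_⟩
    simp only [interK, Finset.mem_filter] at hj
    exact hj.2
  · intro hmem
    simp only [diagSet, Finset.mem_filter, Finset.mem_univ, true_and] at hmem
    exact h ((interK_eq_iff cs I J d).2 hmem.2)

/-- The eigenvalues. -/
noncomputable def eigv (c : Finset B → ℚ) (J : Finset B) : ℚ :=
  ∑ I : Finset B, c I * ((diagSet cs I J).card : ℚ)

theorem triangular (c : Finset B → ℚ) (hc : ∀ I, 0 ≤ c I) (J : Finset B) :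
    (∑ I : Finset B, c I • descentBasis cs I) * descentBasis cs J -
      eigv cs c J • descentBasis cs J ∈
      Submodule.span ℚ (descentBasis cs '' {K | eigv cs c J < eigv cs c K}) := by
  classical
  rw [Finset.sum_mul, eigv, Finset.sum_smul, ← Finset.sum_sub_distrib]
  refine Submodule.sum_mem _ fun I _ => ?_
  rw [smul_mul_assoc, mackey_split, smul_add, smul_smul, add_sub_cancel_left]
  rcases (hc I).eq_or_lt with h0 | hpos
  · rw [← h0, zero_smul]; exact Submodule.zero_mem _
  · refine Submodule.smul_mem _ _ (Submodule.sum_mem _ fun d hd => Submodule.subset_span ?_)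
    simp only [Finset.mem_filter, Finset.mem_univ, true_and] at hd
    refine ⟨_, ?_, rfl⟩
    show eigv cs c J < eigv cs c _
    refine Finset.sum_lt_sum (fun I' _ => ?_) ⟨I, Finset.mem_univ _, ?_⟩
    · refine mul_le_mul_of_nonneg_left ?_ (hc I')
      exact_mod_cast Finset.card_le_card (diagSet_mono cs I' (interK_subset cs I J d))
    · refine mul_lt_mul_of_pos_left ?_ hpos
      exact_mod_cast diagSet_card_lt cs hd.1.1 hd.2

end Cocycle

set_option synthInstance.maxHeartbeats 1000000 in
set_option maxHeartbeats 1000000 in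
/-- For a nonnegative element `a` of the descent algebra and `n ≥ 1`, the centralizer
of `aⁿ` in `Σ(W)` equals the centralizer of `a`. -/
theorem pos_element_power_centralizer {M : CoxeterMatrix B}
    (cs : CoxeterSystem M W) (A : Subalgebra ℚ (MonoidAlgebra ℚ W))
    (hA : IsDescentAlgebra cs A) (a : MonoidAlgebra ℚ W) (c : Finset B → ℚ)
    (hc : ∀ I, 0 ≤ c I) (ha : a = ∑ I : Finset B, c I • descentBasis cs I)
    (n : ℕ) (hn : 1 ≤ n) :
    {x : MonoidAlgebra ℚ W | x ∈ A ∧ a ^ n * x = x * a ^ n} =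
      {x : MonoidAlgebra ℚ W | x ∈ A ∧ a * x = x * a} := by
  subst ha
  ext x
  constructor
  · rintro ⟨hx, h⟩
    refine ⟨hx, ?_⟩
    exact aux_commute (descentBasis cs) _ (eigv cs c)
      (fun J => Finset.sum_nonneg fun I _ => mul_nonneg (hc I) (Nat.cast_nonneg _))
      (triangular cs c hc) Finset.univ (descentBasis_univ cs) n hn x h
  · rintro ⟨hx, h⟩
    exact ⟨hx, (Commute.pow_left (show Commute _ x from h) n).eq⟩
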